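/- arXiv:1903.03504 — 2 statements merged into one kernel-verified Lean document; each statement's English description precedes it below -/
import Mathlib

section
/- Over the alphabet {a, b, 1}, let L₃ = {x 1^n : x ∈ {a,b}*, n = |x|_a} and L₄ = {x 1^n : x ∈ {a,b}*, n = |x|_b}. Then L₃ and L₄ are each counting-regular, but L₅ = L₃ ∪ L₄ is not counting-regular. -/
/-- The counting function of a language: the number of words of length `n`. -/
noncomputable def countFn {α : Type*} (L : Set (List α)) (n : ℕ) : ℕ :=
  Set.ncard {w | w ∈ L ∧ w.length = n}

/-- A language is regular if it is accepted by a DFA with finitely many states. -/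
def IsRegularLang {α : Type*} (L : Set (List α)) : Prop :=
  ∃ (σ : Type) (_ : Fintype σ) (M : DFA α σ), ∀ w, w ∈ M.accepts ↔ w ∈ L

/-- A language is counting-regular if some regular language over a (possibly different)
finite alphabet has the same counting function. -/
def CountingRegular {α : Type*} (L : Set (List α)) : Prop :=
  ∃ (β : Type) (_ : Fintype β) (L' : Set (List β)),
    IsRegularLang L' ∧ ∀ n, countFn L' n = countFn L n


/-- `L₃ = {x 1^n : x ∈ {a,b}*, n = |x|_a}` over `{a, b, 1}` (here `a = 0`, `b = 1`, `1 = 2`). -/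
def L₃ : Set (List (Fin 3)) :=
  {w | ∃ (x : List (Fin 3)) (n : ℕ), (∀ c ∈ x, c = 0 ∨ c = 1) ∧ n = x.count 0 ∧
    w = x ++ List.replicate n 2}

/-- `L₄ = {x 1^n : x ∈ {a,b}*, n = |x|_b}`. -/
def L₄ : Set (List (Fin 3)) :=
  {w | ∃ (x : List (Fin 3)) (n : ℕ), (∀ c ∈ x, c = 0 ∨ c = 1) ∧ n = x.count 1 ∧
    w = x ++ List.replicate n 2}

theorem countFn_range {α γ : Type*} {φ : γ → List α} (hφ : Function.Injective φ) (n : ℕ) :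
    countFn (Set.range φ) n = Set.ncard {x | (φ x).length = n} := by
  rw [countFn, ← Set.ncard_image_of_injective _ hφ]
  congr 1
  ext w
  constructor
  · rintro ⟨⟨x, rfl⟩, h⟩
    exact ⟨x, h, rfl⟩
  · rintro ⟨x, h, rfl⟩
    exact ⟨⟨x, rfl⟩, h⟩

/-! ### Counting functions of regular languages modulo an integer -/

/-- A sequence is eventually periodic. -/
def EventuallyPeriodic {R : Type*} (u : ℕ → R) : Prop :=
  ∃ P > 0, ∃ N, ∀ n ≥ N, u (n + P) = u n

theorem EventuallyPeriodic.map {R S : Type*} {u : ℕ → R} (hu : EventuallyPeriodic u) (g : R → S) :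
    EventuallyPeriodic (fun n => g (u n)) := by
  obtain ⟨P, hP, N, h⟩ := hu
  exact ⟨P, hP, N, fun n hn => congrArg g (h n hn)⟩

theorem EventuallyPeriodic.exists_forall_mul {R : Type*} {u : ℕ → R} (hu : EventuallyPeriodic u) :
    ∃ P > 0, ∃ N, ∀ k, ∀ n ≥ N, u (n + P * k) = u n := by
  obtain ⟨P, hP, N, h⟩ := hu
  refine ⟨P, hP, N, fun k => ?_⟩
  induction k with
  | zero => simp
  | succ k ih =>
    intro n hn
    rw [Nat.mul_succ, ← add_assoc, h _ (by omega), ih n hn]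

theorem EventuallyPeriodic.prodMk {R S : Type*} {u : ℕ → R} {v : ℕ → S}
    (hu : EventuallyPeriodic u) (hv : EventuallyPeriodic v) :
    EventuallyPeriodic (fun n => (u n, v n)) := by
  obtain ⟨P, hP, N, h⟩ := hu.exists_forall_mul
  obtain ⟨Q, hQ, M, h'⟩ := hv.exists_forall_mul
  refine ⟨P * Q, Nat.mul_pos hP hQ, max N M, fun n hn => ?_⟩
  have h₁ := h Q n (le_trans (le_max_left _ _) hn)
  have h₂ := h' P n (le_trans (le_max_right _ _) hn)
  rw [mul_comm Q P] at h₂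
  exact Prod.ext h₁ h₂

theorem EventuallyPeriodic.comp_mul {R : Type*} {u : ℕ → R} (hu : EventuallyPeriodic u)
    {d : ℕ} (hd : 0 < d) : EventuallyPeriodic (fun n => u (d * n)) := by
  obtain ⟨P, hP, N, h⟩ := hu.exists_forall_mul
  refine ⟨P, hP, N, fun n hn => ?_⟩
  have := h d (d * n) (le_trans hn (Nat.le_mul_of_pos_left n hd))
  rwa [mul_comm P d, ← mul_add] at this

theorem eventuallyPeriodic_of_finite {R : Type*} [Finite R] {T : R → R} {u : ℕ → R}
    (hu : ∀ n, u (n + 1) = T (u n)) : EventuallyPeriodic u := by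
  obtain ⟨i, j, hij, h⟩ := Finite.exists_ne_map_eq_of_infinite u
  wlog hlt : i < j generalizing i j
  · exact this j i hij.symm h.symm (by omega)
  refine ⟨j - i, by omega, i, fun n hn => ?_⟩
  induction n, hn using Nat.le_induction with
  | base => rw [Nat.add_sub_cancel' hlt.le, h]
  | succ n _ ih => rw [Nat.add_right_comm, hu, hu, ih]

/-- The number of words of length `n` accepted by `M` from the state `s`. -/
noncomputable def DFA.countFrom {β σ : Type*} (M : DFA β σ) (n : ℕ) (s : σ) : ℕ :=
  countFn {w | M.evalFrom s w ∈ M.accept} n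

theorem DFA.countFrom_succ {β σ : Type*} [Fintype β] (M : DFA β σ) (n : ℕ) (s : σ) :
    M.countFrom (n + 1) s = ∑ b, M.countFrom n (M.step s b) := by
  let W (n : ℕ) (s : σ) : Set (List β) :=
    {w | w ∈ {w | M.evalFrom s w ∈ M.accept} ∧ w.length = n}
  have hfin (n : ℕ) (s : σ) : Finite (W n s) :=
    (List.finite_length_eq β n).subset fun w hw => hw.2
  let f : (Σ b, W n (M.step s b)) → W (n + 1) s := fun p =>
    ⟨p.1 :: p.2.1, ⟨p.2.2.1, congrArg (· + 1) p.2.2.2⟩⟩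
  have hf : Function.Bijective f := by
    constructor
    · rintro ⟨b, w, hw⟩ ⟨c, v, hv⟩ h
      obtain ⟨rfl, rfl⟩ : b = c ∧ w = v := by simpa [f] using h
      rfl
    · rintro ⟨_ | ⟨b, w⟩, hw⟩
      · simp [W] at hw
      · exact ⟨⟨b, w, by simpa [W] using hw⟩, rfl⟩
  exact (Nat.card_congr (Equiv.ofBijective f hf)).symm.trans Nat.card_sigma

theorem CountingRegular.eventuallyPeriodic {α : Type*} {L : Set (List α)} (hL : CountingRegular L)
    (p : ℕ) [NeZero p] : EventuallyPeriodic (fun n => (countFn L n : ZMod p)) := by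
  obtain ⟨β, _, L', ⟨σ, _, M, hM⟩, h⟩ := hL
  have hstart (n : ℕ) : countFn L n = M.countFrom n M.start := by
    rw [← h, show L' = {w | M.evalFrom M.start w ∈ M.accept} from
      Set.ext fun w => (hM w).symm, DFA.countFrom]
  have hper : EventuallyPeriodic (fun n s => (M.countFrom n s : ZMod p)) :=
    eventuallyPeriodic_of_finite (T := fun v s => ∑ b, v (M.step s b)) fun n => by
      funext s
      simp [M.countFrom_succ]
  simpa only [hstart] using hper.map (fun v => v M.start)

/-! ### Central binomial coefficients modulo three -/

theorem centralBinom_three_mul_modEq (m : ℕ) :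
    (3 * m).centralBinom ≡ m.centralBinom [MOD 3] := by
  have : Fact (Nat.Prime 3) := ⟨Nat.prime_three⟩
  have h := Choose.choose_modEq_choose_mod_mul_choose_div_nat
    (n := 2 * (3 * m)) (k := 3 * m) (p := 3)
  rwa [show 2 * (3 * m) % 3 = 0 by omega, show 3 * m % 3 = 0 by omega,
    show 2 * (3 * m) / 3 = 2 * m by omega, show 3 * m / 3 = m by omega,
    Nat.choose_self, one_mul] at h

theorem centralBinom_three_mul_add_two_modEq (m : ℕ) :
    (3 * m + 2).centralBinom ≡ 0 [MOD 3] := by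
  have : Fact (Nat.Prime 3) := ⟨Nat.prime_three⟩
  have h := Choose.choose_modEq_choose_mod_mul_choose_div_nat
    (n := 2 * (3 * m + 2)) (k := 3 * m + 2) (p := 3)
  rwa [show 2 * (3 * m + 2) % 3 = 1 by omega, show (3 * m + 2) % 3 = 2 by omega,
    show Nat.choose 1 2 = 0 by rfl, zero_mul] at h

theorem centralBinom_three_pow_modEq (k : ℕ) : (3 ^ k).centralBinom ≡ 2 [MOD 3] := by
  induction k with
  | zero => rfl
  | succ k ih =>
    rw [pow_succ']
    exact (centralBinom_three_mul_modEq _).trans ih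

theorem not_eventuallyPeriodic_centralBinom :
    ¬ EventuallyPeriodic (fun m => (m.centralBinom : ZMod 3)) := by
  rintro ⟨P, hP, N, h⟩
  simp only [ZMod.natCast_eq_natCast_iff] at h
  induction P using Nat.strong_induction_on with
  | _ P ih =>
    have hN : N < 3 ^ (N + 1) := (Nat.lt_pow_self (by norm_num)).trans
      (Nat.pow_lt_pow_right (by norm_num) (Nat.lt_succ_self N))
    have h3 : 3 ^ (N + 1) = 3 * 3 ^ N := pow_succ' 3 N
    have hpow := centralBinom_three_pow_modEq (N + 1)
    have contra (m : ℕ) (hm : m % 3 = 2)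
        (hmod : m.centralBinom ≡ (3 ^ (N + 1)).centralBinom [MOD 3]) : False := by
      have h0 := centralBinom_three_mul_add_two_modEq (m / 3)
      rw [show 3 * (m / 3) + 2 = m by omega] at h0
      exact absurd (h0.symm.trans (hmod.trans hpow)) (by decide)
    have h₁ := h _ hN.le
    have hcases : P % 3 = 0 ∨ P % 3 = 1 ∨ P % 3 = 2 := by omega
    rcases hcases with hr | hr | hr
    · refine ih (P / 3) (by omega) (by omega) fun n hn => ?_
      have h₂ := h (3 * n) (by omega)
      rw [show 3 * n + P = 3 * (n + P / 3) by omega] at h₂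
      exact (centralBinom_three_mul_modEq _).symm.trans
        (h₂.trans (centralBinom_three_mul_modEq _))
    · exact contra _ (by omega) ((h (3 ^ (N + 1) + P) (by omega)).trans h₁)
    · exact contra _ (by omega) h₁

/-! ### The languages as images of binary words -/

/-- The binary word `x`, with `true` and `false` written as `0` and `1`, followed by as many `2`s
as `x` has letters `c`. -/
def padCount (c : Bool) (x : List Bool) : List (Fin 3) :=
  x.map (fun b => if b then 0 else 1) ++ List.replicate (x.count c) 2

/-- Recovers the binary word from its padding. -/
def unpad (w : List (Fin 3)) : List Bool :=
  w.filterMap ![some true, some false, none]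

theorem unpad_padCount (c : Bool) (x : List Bool) : unpad (padCount c x) = x := by
  have h : (![some true, some false, none] : Fin 3 → Option Bool) ∘
      (fun b => if b then 0 else 1) = some := by
    funext b
    cases b <;> rfl
  rw [unpad, padCount, List.filterMap_append, List.filterMap_map, h, List.filterMap_some,
    List.filterMap_replicate_of_none rfl, List.append_nil]

theorem padCount_injective (c : Bool) : Function.Injective (padCount c) :=
  Function.LeftInverse.injective (unpad_padCount c)

theorem length_padCount (c : Bool) (x : List Bool) :
    (padCount c x).length = x.length + x.count c := by
  simp [padCount]

theorem exists_map_eq_of_forall {x : List (Fin 3)} (hx : ∀ c ∈ x, c = 0 ∨ c = 1) :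
    ∃ y : List Bool, y.map (fun b => if b then (0 : Fin 3) else 1) = x := by
  refine ⟨x.map (· = 0), ?_⟩
  rw [List.map_map]
  conv_rhs => rw [← List.map_id x]
  refine List.map_congr_left fun c hc => ?_
  rcases hx c hc with rfl | rfl <;> simp

theorem count_map_zero (y : List Bool) :
    (y.map (fun b => if b then (0 : Fin 3) else 1)).count 0 = y.count true := by
  induction y with
  | nil => rfl
  | cons b y ih => cases b <;> simp [ih]

theorem count_map_one (y : List Bool) :
    (y.map (fun b => if b then (0 : Fin 3) else 1)).count 1 = y.count false := by
  induction y with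
  | nil => rfl
  | cons b y ih => cases b <;> simp [ih]

theorem L₃_eq_range : L₃ = Set.range (padCount true) := by
  ext w
  constructor
  · rintro ⟨x, n, hx, rfl, rfl⟩
    obtain ⟨y, rfl⟩ := exists_map_eq_of_forall hx
    exact ⟨y, by rw [padCount, count_map_zero]⟩
  · rintro ⟨y, rfl⟩
    refine ⟨_, _, ?_, (count_map_zero y).symm, rfl⟩
    simp only [List.mem_map]
    rintro _ ⟨_ | _, _, rfl⟩ <;> simp

theorem L₄_eq_range : L₄ = Set.range (padCount false) := by
  ext w
  constructor
  · rintro ⟨x, n, hx, rfl, rfl⟩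
    obtain ⟨y, rfl⟩ := exists_map_eq_of_forall hx
    exact ⟨y, by rw [padCount, count_map_one]⟩
  · rintro ⟨y, rfl⟩
    refine ⟨_, _, ?_, (count_map_one y).symm, rfl⟩
    simp only [List.mem_map]
    rintro _ ⟨_ | _, _, rfl⟩ <;> simp

/-! ### Counting regularity of the padded languages -/

/-- Encodes the letter `c` as `[true, false]` and the other letter as `[false]`. -/
def encodeWord (c : Bool) (x : List Bool) : List Bool :=
  x.flatMap fun b => if b = c then [true, false] else [false]

theorem encodeWord_cons (c b : Bool) (x : List Bool) :
    encodeWord c (b :: x) = (if b = c then [true, false] else [false]) ++ encodeWord c x :=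
  List.flatMap_cons

theorem length_encodeWord (c : Bool) (x : List Bool) :
    (encodeWord c x).length = x.length + x.count c := by
  induction x with
  | nil => rfl
  | cons b x ih =>
    by_cases h : b = c <;> simp [encodeWord_cons, h, ih] <;> omega

theorem encodeWord_injective (c : Bool) : Function.Injective (encodeWord c) := by
  intro x
  induction x with
  | nil =>
    rintro (_ | ⟨b, y⟩) h
    · rfl
    · have := congrArg List.length h
      simp only [length_encodeWord, List.length_cons, List.length_nil, List.count_nil] at this
      omega
  | cons a x ih =>
    rintro (_ | ⟨b, y⟩) h
    · have := congrArg List.length h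
      simp only [length_encodeWord, List.length_cons, List.length_nil, List.count_nil] at this
      omega
    · rw [encodeWord_cons, encodeWord_cons] at h
      by_cases ha : a = c <;> by_cases hb : b = c <;> simp [ha, hb] at h
      · rw [ha, hb, ih h]
      · rw [Bool.eq_not_of_ne ha, Bool.eq_not_of_ne hb, ih h]

/-- An automaton for the words in which every `true` is followed by a `false`; its states are
`0` (accepting), `1` (a `false` is expected) and `2` (a dead state). -/
def trueFalseDFA : DFA Bool (Fin 3) where
  step s b := if b then ![1, 2, 2] s else ![0, 0, 2] s
  start := 0
  accept := {0}

theorem trueFalseDFA_evalFrom_two (w : List Bool) : trueFalseDFA.evalFrom 2 w = 2 := by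
  induction w with
  | nil => rfl
  | cons b w ih => cases b <;> exact ih

theorem trueFalseDFA_evalFrom_encodeWord (c : Bool) (x : List Bool) :
    trueFalseDFA.evalFrom 0 (encodeWord c x) = 0 := by
  induction x with
  | nil => rfl
  | cons b x ih =>
    rw [encodeWord_cons]
    split <;> exact ih

theorem exists_encodeWord_eq (c : Bool) :
    ∀ w, trueFalseDFA.evalFrom 0 w = 0 → ∃ x, encodeWord c x = w
  | [], _ => ⟨[], rfl⟩
  | false :: w, h => by
    obtain ⟨x, rfl⟩ := exists_encodeWord_eq c w h
    exact ⟨(!c) :: x, by simp [encodeWord_cons]⟩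
  | [true], h => absurd h (by decide)
  | true :: false :: w, h => by
    obtain ⟨x, rfl⟩ := exists_encodeWord_eq c w h
    exact ⟨c :: x, by simp [encodeWord_cons]⟩
  | true :: true :: w, h =>
    absurd ((trueFalseDFA_evalFrom_two w).symm.trans h) (by decide)

theorem countingRegular_range_padCount (c : Bool) : CountingRegular (Set.range (padCount c)) := by
  refine ⟨Bool, inferInstance, Set.range (encodeWord c),
    ⟨Fin 3, inferInstance, trueFalseDFA, fun w => ⟨exists_encodeWord_eq c w, ?_⟩⟩, fun n => ?_⟩
  · rintro ⟨x, rfl⟩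
    exact trueFalseDFA_evalFrom_encodeWord c x
  · simp only [countFn_range (encodeWord_injective c), countFn_range (padCount_injective c),
      length_encodeWord, length_padCount]

/-! ### The union -/

/-- Binary words with `p` letters `true` and `q` letters `false`. -/
def wordsWithCounts (p q : ℕ) : Set (List Bool) :=
  {x | x.count true = p ∧ x.count false = q}

theorem length_eq_of_mem_wordsWithCounts {p q : ℕ} {x : List Bool}
    (hx : x ∈ wordsWithCounts p q) : x.length = p + q := by
  rw [← hx.1, ← hx.2, List.count_true_add_count_false]

theorem finite_wordsWithCounts (p q : ℕ) : (wordsWithCounts p q).Finite :=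
  (List.finite_length_eq Bool (p + q)).subset fun _ => length_eq_of_mem_wordsWithCounts

theorem wordsWithCounts_zero_left (q : ℕ) :
    wordsWithCounts 0 q = {List.replicate q false} := by
  ext x
  constructor
  · intro hx
    have hlen := length_eq_of_mem_wordsWithCounts hx
    refine List.eq_replicate_iff.2 ⟨by omega, fun b hb => ?_⟩
    cases b
    · rfl
    · exact absurd hb (List.count_eq_zero.1 hx.1)
  · rintro rfl
    simp [wordsWithCounts, List.count_replicate]

theorem wordsWithCounts_zero_right (p : ℕ) :
    wordsWithCounts p 0 = {List.replicate p true} := by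
  ext x
  constructor
  · intro hx
    have hlen := length_eq_of_mem_wordsWithCounts hx
    refine List.eq_replicate_iff.2 ⟨by omega, fun b hb => ?_⟩
    cases b
    · exact absurd hb (List.count_eq_zero.1 hx.2)
    · rfl
  · rintro rfl
    simp [wordsWithCounts, List.count_replicate]

theorem wordsWithCounts_succ_succ (p q : ℕ) :
    wordsWithCounts (p + 1) (q + 1) =
      List.cons true '' wordsWithCounts p (q + 1) ∪
        List.cons false '' wordsWithCounts (p + 1) q := by
  ext x
  rcases x with _ | ⟨_ | _, x⟩ <;> simp [wordsWithCounts]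

theorem ncard_wordsWithCounts (p q : ℕ) : (wordsWithCounts p q).ncard = (p + q).choose p := by
  induction p generalizing q with
  | zero => simp [wordsWithCounts_zero_left]
  | succ p ihp =>
    induction q with
    | zero => simp [wordsWithCounts_zero_right]
    | succ q ihq =>
      rw [wordsWithCounts_succ_succ, Set.ncard_union_eq ?_
        ((finite_wordsWithCounts _ _).image _) ((finite_wordsWithCounts _ _).image _),
        Set.ncard_image_of_injective _ List.cons_injective,
        Set.ncard_image_of_injective _ List.cons_injective, ihp, ihq,
        show p + 1 + (q + 1) = p + (q + 1) + 1 by omega, Nat.choose_succ_succ,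
        show p + (q + 1) = p + 1 + q by omega]
      rw [Set.disjoint_left]
      rintro _ ⟨x, _, rfl⟩ ⟨y, _, h⟩
      simp at h

theorem countFn_union_add_countFn_inter {α : Type*} [Finite α] (L L' : Set (List α)) (n : ℕ) :
    countFn (L ∪ L') n + countFn (L ∩ L') n = countFn L n + countFn L' n := by
  have hfin (K : Set (List α)) : {w | w ∈ K ∧ w.length = n}.Finite :=
    (List.finite_length_eq α n).subset fun w hw => hw.2
  rw [countFn, countFn, countFn, countFn, ← Set.ncard_union_add_ncard_inter _ _ (hfin L) (hfin L')]
  congr 2 <;> ext w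
  · exact or_and_right
  · exact and_and_right

theorem countFn_range_inter_range (m : ℕ) :
    countFn (Set.range (padCount true) ∩ Set.range (padCount false)) (3 * m) =
      m.centralBinom := by
  rw [Nat.centralBinom, two_mul, ← ncard_wordsWithCounts,
    ← Set.ncard_image_of_injective _ (padCount_injective true), countFn]
  congr 1
  ext w
  constructor
  · rintro ⟨⟨⟨x, rfl⟩, y, hy⟩, hlen⟩
    obtain rfl : y = x := by rw [← unpad_padCount false y, hy, unpad_padCount]
    have h := congrArg List.length hy
    have htot := List.count_true_add_count_false y
    rw [length_padCount] at hlen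
    rw [length_padCount, length_padCount] at h
    exact ⟨y, ⟨by omega, by omega⟩, rfl⟩
  · rintro ⟨x, hx, rfl⟩
    refine ⟨⟨⟨x, rfl⟩, x, ?_⟩, ?_⟩
    · rw [padCount, padCount, hx.1, hx.2]
    · rw [length_padCount, length_eq_of_mem_wordsWithCounts hx, hx.1]
      omega

/-- `L₃` and `L₄` are counting-regular, but `L₅ = L₃ ∪ L₄` is not. -/
theorem stmt3 :
    CountingRegular L₃ ∧ CountingRegular L₄ ∧ ¬ CountingRegular (L₃ ∪ L₄) := by
  have h₃ : CountingRegular L₃ := L₃_eq_range ▸ countingRegular_range_padCount true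
  have h₄ : CountingRegular L₄ := L₄_eq_range ▸ countingRegular_range_padCount false
  refine ⟨h₃, h₄, fun h₅ => not_eventuallyPeriodic_centralBinom ?_⟩
  have hper := (((h₃.eventuallyPeriodic 3).prodMk ((h₄.eventuallyPeriodic 3).prodMk
    (h₅.eventuallyPeriodic 3))).map fun v => v.1 + v.2.1 - v.2.2).comp_mul (d := 3) (by norm_num)
  convert hper using 2 with m
  rw [← countFn_range_inter_range, ← L₃_eq_range, ← L₄_eq_range, eq_sub_iff_add_eq']
  dsimp only
  rw [← Nat.cast_add, ← Nat.cast_add, countFn_union_add_countFn_inter]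
end

section
/- There exist a finite alphabet Σ and a language L ⊆ Σ* such that L is counting-regular but its complement Σ* \ L is not counting-regular. -/
/-- The operator `f ↦ (q ↦ ∑ a, f (δ q a))` attached to a transition function. -/
def transferMap {σ β : Type*} [Fintype β] (R : Type*) [CommSemiring R] (δ : σ → β → σ) :
    (σ → R) →ₗ[R] (σ → R) where
  toFun f q := ∑ a, f (δ q a)
  map_add' f g := by ext q; simp [Finset.sum_add_distrib]
  map_smul' c f := by ext q; simp [Finset.mul_sum]

lemma transferMap_apply {σ β : Type*} [Fintype β] {R : Type*} [CommSemiring R]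
    (δ : σ → β → σ) (f : σ → R) (q : σ) : transferMap R δ f q = ∑ a, f (δ q a) := rfl

/-- The number of words of length `n` that lead from `q` to a state in `F`. -/
noncomputable def acceptCount {σ β : Type*} [Fintype β] (δ : σ → β → σ) (F : Set σ) :
    ℕ → σ → ℕ
  | 0, q => Set.indicator F 1 q
  | n + 1, q => ∑ a, acceptCount δ F n (δ q a)

lemma countFn_acceptsFrom {σ β : Type*} [Fintype β] (M : DFA β σ) (n : ℕ) (q : σ) :
    countFn (M.acceptsFrom q : Set (List β)) n = acceptCount M.step M.accept n q := by
  induction n generalizing q with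
  | zero =>
    by_cases h : q ∈ M.accept
    · have : {w | w ∈ (M.acceptsFrom q : Set (List β)) ∧ w.length = 0} = {[]} := by
        ext w
        constructor
        · rintro ⟨-, h2⟩
          simpa using h2
        · rintro rfl
          exact ⟨h, rfl⟩
      refine (congrArg Set.ncard this).trans ?_
      simp [acceptCount, h]
    · have : {w | w ∈ (M.acceptsFrom q : Set (List β)) ∧ w.length = 0} = ∅ := by
        ext w
        constructor
        · rintro ⟨h1, h2⟩
          obtain rfl : w = [] := by simpa using h2
          exact h h1
        · rintro ⟨⟩
      refine (congrArg Set.ncard this).trans ?_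
      simp [acceptCount, h]
  | succ n ih =>
    have hfin : ∀ p : σ,
        Finite {w | w ∈ (M.acceptsFrom p : Set (List β)) ∧ w.length = n} := fun p =>
      (List.finite_length_eq β n).subset fun w hw => hw.2
    let e : {w | w ∈ (M.acceptsFrom q : Set (List β)) ∧ w.length = n + 1} ≃
        Σ a, {w | w ∈ (M.acceptsFrom (M.step q a) : Set (List β)) ∧ w.length = n} :=
      Equiv.symm <| Equiv.ofBijective
        (fun p => ⟨p.1 :: p.2.1, p.2.2.1, by simpa using p.2.2.2⟩) <| by
          constructor
          · rintro ⟨a, w, hw⟩ ⟨b, w', hw'⟩ h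
            simp only [Subtype.mk.injEq, List.cons.injEq] at h
            obtain ⟨rfl, rfl⟩ := h
            rfl
          · rintro ⟨w, h1, h2⟩
            cases w with
            | nil => simp at h2
            | cons a w => exact ⟨⟨a, w, h1, by simpa using h2⟩, rfl⟩
    simp only [acceptCount]
    refine ((Nat.card_coe_set_eq _).symm.trans (Nat.card_congr e)).trans ?_
    rw [Nat.card_sigma]
    refine Finset.sum_congr rfl fun a _ => ?_
    rw [← ih]
    exact Nat.card_coe_set_eq _

lemma acceptCount_evalFrom_le {σ β : Type*} [Fintype β] (M : DFA β σ) (F : Set σ) (n : ℕ)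
    (w : List β) (q : σ) :
    acceptCount M.step F n (M.evalFrom q w) ≤ acceptCount M.step F (n + w.length) q := by
  induction w generalizing q with
  | nil => simp
  | cons a w ih =>
    rw [DFA.evalFrom_cons]
    refine (ih _).trans ?_
    rw [List.length_cons, ← add_assoc, acceptCount]
    exact Finset.single_le_sum (f := fun a => acceptCount M.step F (n + w.length) (M.step q a))
      (fun _ _ => Nat.zero_le _) (Finset.mem_univ a)

/-- The restriction of a DFA to its reachable states. -/
def DFA.reachablePart {σ β : Type*} (M : DFA β σ) : DFA β {q // ∃ w, M.eval w = q} where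
  step q a := ⟨M.step q.1 a, by
    obtain ⟨w, hw⟩ := q.2
    exact ⟨w ++ [a], by simp [hw]⟩⟩
  start := ⟨M.start, [], rfl⟩
  accept := {q | q.1 ∈ M.accept}

lemma DFA.acceptCount_reachablePart {σ β : Type*} [Fintype β] (M : DFA β σ) (n : ℕ)
    (q : {q // ∃ w, M.eval w = q}) :
    acceptCount M.reachablePart.step M.reachablePart.accept n q =
      acceptCount M.step M.accept n q.1 := by
  induction n generalizing q with
  | zero => rfl
  | succ n ih =>
    simp only [acceptCount, ih]
    rfl

/-- Equality case of the triangle inequality: an eigenvector of a transfer map that is dominated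
by a nonnegative eigenvector of eigenvalue `‖l‖ = ρ` has eigenvalue a root of unity times `ρ`. -/
lemma exists_pow_eq_of_dominated {σ β : Type*} [Finite σ] [Fintype β] (δ : σ → β → σ)
    {x : σ → ℂ} (hx0 : x ≠ 0) {l : ℂ} {ρ : ℝ} (hρ : 0 < ρ) (hl : ‖l‖ = ρ)
    (hx : ∀ q, ∑ a, x (δ q a) = l * x q) {w : σ → ℝ} (hxw : ∀ q, ‖x q‖ ≤ w q)
    (hw : ∀ q, ∑ a, w (δ q a) = ρ * w q) : ∃ p, 0 < p ∧ l ^ p = (ρ : ℂ) ^ p := by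
  have hw0 : ∀ q, 0 ≤ w q := fun q => (norm_nonneg _).trans (hxw q)
  obtain ⟨q₁, hq₁⟩ : ∃ q, x q ≠ 0 := Function.ne_iff.mp hx0
  have : Nonempty σ := ⟨q₁⟩
  obtain ⟨q₀, hq₀⟩ := Finite.exists_max fun q => ‖x q‖ / w q
  obtain ⟨t, ht⟩ : ∃ t, t = ‖x q₀‖ / w q₀ := ⟨_, rfl⟩
  have hq₁w : 0 < w q₁ := (norm_pos_iff.mpr hq₁).trans_le (hxw q₁)
  have htpos : 0 < t := by
    rw [ht]
    exact (div_pos (norm_pos_iff.mpr hq₁) hq₁w).trans_le (hq₀ q₁)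
  have hxt : ∀ q, ‖x q‖ ≤ t * w q := by
    intro q
    rcases (hw0 q).eq_or_lt with h | h
    · have := hxw q
      rw [← h] at this ⊢
      simpa using this
    · rw [← div_le_iff₀ h, ht]
      exact hq₀ q
  have hq₀w : 0 < w q₀ := by
    rcases (hw0 q₀).eq_or_lt with h | h
    · rw [ht, ← h] at htpos
      simp at htpos
    · exact h
  have hρ' : (ρ : ℂ) ≠ 0 := by exact_mod_cast hρ.ne'
  have key : ∀ ζ : ℂ, ‖ζ‖ = t → ∀ q, 0 < w q → x q = ζ * w q →
      ∃ q', 0 < w q' ∧ x q' = (l / ρ * ζ) * w q' := by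
    intro ζ hζ q hq hxq
    set ξ : ℂ := l / ρ * ζ with hξ
    have hξn : ‖ξ‖ = t := by
      rw [hξ, norm_mul, norm_div, hl, hζ, Complex.norm_real, Real.norm_of_nonneg hρ.le,
        div_self hρ.ne', one_mul]
    have hξsq : ξ.re ^ 2 + ξ.im ^ 2 = t ^ 2 := by
      rw [← hξn, ← Complex.normSq_eq_norm_sq, Complex.normSq_apply]
      ring
    have hsum : ∑ a, (ξ * w (δ q a) - x (δ q a)) = 0 := by
      rw [Finset.sum_sub_distrib, hx, ← Finset.mul_sum, ← Complex.ofReal_sum, hw, hxq, hξ]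
      push_cast
      field_simp
      ring
    have hterm : ∀ q', 0 ≤ (starRingEnd ℂ ξ * (ξ * w q' - x q')).re := by
      intro q'
      have h1 : (starRingEnd ℂ ξ * x q').re ≤ t * (t * w q') := by
        refine (Complex.re_le_norm _).trans ?_
        rw [norm_mul, Complex.norm_conj, hξn]
        exact mul_le_mul_of_nonneg_left (hxt q') htpos.le
      have h2 : (starRingEnd ℂ ξ * (ξ * w q' - x q')).re =
          (ξ.re ^ 2 + ξ.im ^ 2) * w q' - (starRingEnd ℂ ξ * x q').re := by
        simp
        ring
      rw [h2, hξsq]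
      linarith
    have hzero : ∀ a, (starRingEnd ℂ ξ * (ξ * w (δ q a) - x (δ q a))).re = 0 := by
      have : ∑ a, (starRingEnd ℂ ξ * (ξ * w (δ q a) - x (δ q a))).re = 0 := by
        rw [← Complex.re_sum, ← Finset.mul_sum, hsum]
        simp
      intro a
      exact (Finset.sum_eq_zero_iff_of_nonneg fun a _ => hterm _).mp this a (Finset.mem_univ a)
    obtain ⟨a, ha⟩ : ∃ a, 0 < w (δ q a) := by
      by_contra! h
      have h1 : ∑ a, w (δ q a) ≤ 0 := Finset.sum_nonpos fun a _ => h a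
      rw [hw] at h1
      have := mul_pos hρ hq
      linarith
    refine ⟨δ q a, ha, ?_⟩
    have h1 := hzero a
    have h2 : (x (δ q a)).re ^ 2 + (x (δ q a)).im ^ 2 ≤ (t * w (δ q a)) ^ 2 := by
      have h3 := pow_le_pow_left₀ (norm_nonneg _) (hxt (δ q a)) 2
      rw [← Complex.normSq_eq_norm_sq, Complex.normSq_apply] at h3
      linarith
    simp at h1
    have h4 : ((x (δ q a)).re - ξ.re * w (δ q a)) ^ 2 +
        ((x (δ q a)).im - ξ.im * w (δ q a)) ^ 2 ≤ 0 := by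
      linear_combination h2 + 2 * w (δ q a) * h1 - w (δ q a) ^ 2 * hξsq
    have h5 : (x (δ q a)).re - ξ.re * w (δ q a) = 0 := by
      nlinarith [sq_nonneg ((x (δ q a)).im - ξ.im * w (δ q a)),
        sq_nonneg ((x (δ q a)).re - ξ.re * w (δ q a))]
    have h6 : (x (δ q a)).im - ξ.im * w (δ q a) = 0 := by
      nlinarith [sq_nonneg ((x (δ q a)).im - ξ.im * w (δ q a)),
        sq_nonneg ((x (δ q a)).re - ξ.re * w (δ q a))]
    apply Complex.ext
    · simp
      linarith
    · simp
      linarith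
  have hω : ‖l / ρ‖ = 1 := by
    rw [norm_div, hl, Complex.norm_real, Real.norm_of_nonneg hρ.le, div_self hρ.ne']
  have hz₀ : ‖x q₀ / w q₀‖ = t := by
    rw [norm_div, Complex.norm_real, Real.norm_of_nonneg hq₀w.le, ht]
  have orbit : ∀ n : ℕ, ∃ q, 0 < w q ∧ x q = ((l / ρ) ^ n * (x q₀ / w q₀)) * w q := by
    intro n
    induction n with
    | zero =>
      refine ⟨q₀, hq₀w, ?_⟩
      have : (w q₀ : ℂ) ≠ 0 := by exact_mod_cast hq₀w.ne'
      field_simp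
    | succ n ih =>
      obtain ⟨q, hq, hxq⟩ := ih
      obtain ⟨q', hq', hxq'⟩ := key _ (by rw [norm_mul, norm_pow, hω, hz₀]; simp) q hq hxq
      exact ⟨q', hq', by rw [hxq']; ring⟩
  choose s hs hsx using orbit
  obtain ⟨m, n, hmn, hs_eq⟩ := Finite.exists_ne_map_eq_of_infinite s
  wlog hlt : m < n generalizing m n
  · exact this n m hmn.symm hs_eq.symm (by omega)
  refine ⟨n - m, by omega, ?_⟩
  have h1 := hsx m
  rw [hs_eq, hsx n] at h1
  have hwn : (w (s n) : ℂ) ≠ 0 := by exact_mod_cast (hs n).ne'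
  have hz : x q₀ / w q₀ ≠ 0 := by
    rw [← norm_ne_zero_iff, hz₀]
    exact htpos.ne'
  have h2 := mul_right_cancel₀ hz (mul_right_cancel₀ hwn h1)
  have hω0 : l / ρ ≠ 0 := by
    rw [← norm_ne_zero_iff, hω]
    exact one_ne_zero
  obtain ⟨k, rfl⟩ := Nat.exists_eq_add_of_lt hlt
  have h3 : (l / ρ) ^ (k + 1) = 1 := by
    have : (l / ρ) ^ m * (l / ρ) ^ (k + 1) = (l / ρ) ^ m * 1 := by
      rw [← pow_add, mul_one, ← h2]
      rfl
    exact mul_left_cancel₀ (pow_ne_zero _ hω0) this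
  rw [show m + k + 1 - m = k + 1 by omega]
  rwa [div_pow, div_eq_one_iff_eq (pow_ne_zero _ hρ')] at h3

/-- A subinvariant function with controlled growth is dominated by an eigenfunction. -/
lemma exists_eigenfunction_ge {σ β : Type*} [Fintype β] (δ : σ → β → σ) {z : σ → ℝ}
    {ρ : ℝ} (hρ : 0 < ρ) (hz : ∀ q, ρ * z q ≤ ∑ a, z (δ q a)) {K : ℝ}
    (hK : ∀ n q, ((transferMap ℝ δ) ^ n) z q ≤ K * ρ ^ n) :
    ∃ w : σ → ℝ, (∀ q, z q ≤ w q) ∧ ∀ q, ∑ a, w (δ q a) = ρ * w q := by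
  set u : σ → ℕ → ℝ := fun q n => ((transferMap ℝ δ) ^ n) z q / ρ ^ n with hu
  have hstep : ∀ q n, ∑ a, u (δ q a) n = ρ * u q (n + 1) := by
    intro q n
    simp only [hu]
    rw [← Finset.sum_div, pow_succ' (transferMap ℝ δ), Module.End.mul_apply, transferMap_apply]
    field_simp
    ring
  have hmono : ∀ n q, u q n ≤ u q (n + 1) := by
    intro n
    induction n with
    | zero =>
      intro q
      have h := hz q
      simp only [hu, pow_zero, zero_add, pow_one, div_one, Module.End.one_apply,
        transferMap_apply]
      rw [le_div_iff₀ hρ]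
      linarith
    | succ n ih =>
      intro q
      have h : ∑ a, u (δ q a) n ≤ ∑ a, u (δ q a) (n + 1) := Finset.sum_le_sum fun a _ => ih _
      rw [hstep, hstep] at h
      exact le_of_mul_le_mul_left h hρ
  have hbdd : ∀ q, BddAbove (Set.range (u q)) := by
    intro q
    refine ⟨K, ?_⟩
    rintro _ ⟨n, rfl⟩
    simp only [hu]
    rw [div_le_iff₀ (pow_pos hρ n)]
    exact hK n q
  have hlim : ∀ q, Filter.Tendsto (u q) Filter.atTop (nhds (⨆ n, u q n)) := fun q =>
    tendsto_atTop_ciSup (monotone_nat_of_le_succ fun n => hmono n q) (hbdd q)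
  refine ⟨fun q => ⨆ n, u q n, fun q => ?_, fun q => ?_⟩
  · have := le_ciSup (hbdd q) 0
    simpa [hu] using this
  · have h1 : Filter.Tendsto (fun n => ∑ a, u (δ q a) n) Filter.atTop
        (nhds (∑ a, ⨆ n, u (δ q a) n)) := tendsto_finsetSum _ fun a _ => hlim _
    have h2 : Filter.Tendsto (fun n => ρ * u q (n + 1)) Filter.atTop
        (nhds (ρ * ⨆ n, u q n)) :=
      ((hlim q).comp (Filter.tendsto_add_atTop_nat 1)).const_mul ρ
    refine tendsto_nhds_unique h1 (h2.congr fun n => (hstep q n).symm)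

lemma transferMap_pow_mono {σ β : Type*} [Fintype β] (δ : σ → β → σ) (n : ℕ) {f g : σ → ℝ}
    (h : ∀ q, f q ≤ g q) (q : σ) :
    ((transferMap ℝ δ) ^ n) f q ≤ ((transferMap ℝ δ) ^ n) g q := by
  induction n generalizing q with
  | zero => exact h q
  | succ n ih =>
    rw [pow_succ', Module.End.mul_apply, Module.End.mul_apply, transferMap_apply,
      transferMap_apply]
    exact Finset.sum_le_sum fun a _ => ih _

lemma transferMap_pow_acceptCount {σ β : Type*} [Fintype β] (R : Type*) [CommSemiring R]
    (δ : σ → β → σ) (F : Set σ) (n m : ℕ) :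
    ((transferMap R δ) ^ n) (fun q => (acceptCount δ F m q : R)) =
      fun q => (acceptCount δ F (n + m) q : R) := by
  induction n with
  | zero => simp
  | succ n ih =>
    rw [pow_succ', Module.End.mul_apply, ih]
    ext q
    rw [transferMap_apply, Nat.add_right_comm, acceptCount]
    push_cast
    rfl

open Polynomial in
/-- If accepted words from every state number `O(ρ ^ n)`, and every polynomial killing the vector
of accepting states vanishes at `l` with `‖l‖ = ρ`, then `l / ρ` is a root of unity. -/
lemma exists_pow_eq_of_growth {σ β : Type*} [Finite σ] [Fintype β] (δ : σ → β → σ) (F : Set σ)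
    {l : ℂ} {ρ : ℝ} (hρ : 0 < ρ) (hl : ‖l‖ = ρ) {C : ℝ}
    (hC : ∀ n q, (acceptCount δ F n q : ℝ) ≤ C * ρ ^ n)
    (hroot : ∀ P : ℂ[X],
      aeval (transferMap ℂ δ) P (fun q => (acceptCount δ F 0 q : ℂ)) = 0 → P.IsRoot l) :
    ∃ p, 0 < p ∧ l ^ p = (ρ : ℂ) ^ p := by
  set T := transferMap ℂ δ
  set v : σ → ℂ := fun q => (acceptCount δ F 0 q : ℂ)
  have hex : ∃ d, ∃ P : ℂ[X], P ≠ 0 ∧ aeval T P v = 0 ∧ P.natDegree = d :=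
    ⟨_, minpoly ℂ T, minpoly.ne_zero (Algebra.IsIntegral.isIntegral T),
      by rw [minpoly.aeval]; rfl, rfl⟩
  classical
  obtain ⟨P, hP0, hPv, hPd⟩ := Nat.find_spec hex
  obtain ⟨Q, rfl⟩ := dvd_iff_isRoot.mpr (hroot P hPv)
  have hQ0 : Q ≠ 0 := right_ne_zero_of_mul hP0
  have hQv : aeval T Q v ≠ 0 := by
    intro h
    refine Nat.find_min hex (m := Q.natDegree) ?_ ⟨Q, hQ0, h, rfl⟩
    rw [← hPd, natDegree_mul (X_sub_C_ne_zero l) hQ0, natDegree_X_sub_C]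
    omega
  set x := aeval T Q v with hxdef
  have hx : ∀ q, ∑ a, x (δ q a) = l * x q := by
    intro q
    rw [map_mul, Module.End.mul_apply] at hPv
    have := congrFun hPv q
    simp only [map_sub, aeval_X, aeval_C, LinearMap.sub_apply, Module.algebraMap_end_apply,
      Pi.sub_apply, Pi.smul_apply, smul_eq_mul, Pi.zero_apply] at this
    exact sub_eq_zero.mp this
  set I := Finset.range (Q.natDegree + 1)
  have hxq : ∀ q, x q = ∑ m ∈ I, Q.coeff m * (acceptCount δ F m q : ℂ) := by
    intro q
    rw [hxdef, aeval_eq_sum_range, LinearMap.sum_apply, Finset.sum_apply]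
    refine Finset.sum_congr rfl fun m _ => ?_
    rw [LinearMap.smul_apply, transferMap_pow_acceptCount]
    simp
  set y : σ → ℝ := ∑ m ∈ I, ‖Q.coeff m‖ • fun q => (acceptCount δ F m q : ℝ) with hy
  have hxy : ∀ q, ‖x q‖ ≤ y q := by
    intro q
    rw [hxq, hy, Finset.sum_apply]
    refine (norm_sum_le _ _).trans (le_of_eq ?_)
    simp
  obtain ⟨w, hxw, hw⟩ := exists_eigenfunction_ge δ (z := fun q => ‖x q‖) hρ
    (K := ∑ m ∈ I, ‖Q.coeff m‖ * (C * ρ ^ m))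
    (fun q => by
      rw [← hl, ← norm_mul, ← hx]
      exact norm_sum_le _ _)
    (fun n q => by
      refine (transferMap_pow_mono δ n hxy q).trans ?_
      rw [hy, map_sum, Finset.sum_apply, Finset.sum_mul]
      refine Finset.sum_le_sum fun m _ => ?_
      rw [map_smul, transferMap_pow_acceptCount, Pi.smul_apply, smul_eq_mul, mul_assoc]
      refine mul_le_mul_of_nonneg_left ((hC _ _).trans_eq ?_) (norm_nonneg _)
      rw [pow_add]
      ring)
  exact exists_pow_eq_of_dominated δ hQv hρ hl hx hxw hw

/-- The pairs `(Re, Im)` of `(1 + i) (3 + 4 * i) ^ n`. -/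
def gaussPow : ℕ → ℤ × ℤ
  | 0 => (1, 1)
  | n + 1 => (3 * (gaussPow n).1 - 4 * (gaussPow n).2, 4 * (gaussPow n).1 + 3 * (gaussPow n).2)

lemma gaussPow_sq (n : ℕ) : (gaussPow n).1 ^ 2 + (gaussPow n).2 ^ 2 = 2 * (5 ^ n) ^ 2 := by
  induction n with
  | zero => simp [gaussPow]
  | succ n ih =>
    simp only [gaussPow]
    rw [pow_succ]
    linear_combination 25 * ih

lemma abs_gaussPow_le (n : ℕ) : |(gaussPow n).1| ≤ 2 * 5 ^ n := by
  refine abs_le_of_sq_le_sq ?_ (by positivity)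
  nlinarith [gaussPow_sq n, sq_nonneg (gaussPow n).2, sq_nonneg ((5 : ℤ) ^ n)]

lemma gaussPow_complex (n : ℕ) :
    ((gaussPow n).1 : ℂ) =
      ((1 + Complex.I) * (3 + 4 * Complex.I) ^ n +
        (1 - Complex.I) * (3 - 4 * Complex.I) ^ n) / 2 ∧
    ((gaussPow n).2 : ℂ) =
      ((1 - Complex.I) * (3 + 4 * Complex.I) ^ n +
        (1 + Complex.I) * (3 - 4 * Complex.I) ^ n) / 2 := by
  induction n with
  | zero => simp [gaussPow]
  | succ n ih =>
    obtain ⟨h1, h2⟩ := ih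
    simp only [gaussPow]
    push_cast
    rw [h1, h2]
    constructor
    · linear_combination (-2 * (3 + 4 * Complex.I) ^ n - 2 * (3 - 4 * Complex.I) ^ n) * Complex.I_sq
    · linear_combination (2 * (3 + 4 * Complex.I) ^ n + 2 * (3 - 4 * Complex.I) ^ n) * Complex.I_sq

lemma gauss_pow_ne (p : ℕ) (hp : 0 < p) : (3 + 4 * Complex.I) ^ p ≠ ((5 : ℝ) : ℂ) ^ p := by
  have h : ∀ n : ℕ, ∃ a b : ℤ, (3 + 4 * Complex.I) ^ (n + 1) =
      ((5 * a + 3 : ℤ) : ℂ) + ((5 * b + 4 : ℤ) : ℂ) * Complex.I := by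
    intro n
    induction n with
    | zero => exact ⟨0, 0, by simp⟩
    | succ n ih =>
      obtain ⟨a, b, hab⟩ := ih
      refine ⟨3 * a - 4 * b - 2, 4 * a + 3 * b + 4, ?_⟩
      rw [pow_succ, hab]
      push_cast
      linear_combination (4 * (5 * b + 4) : ℂ) * Complex.I_sq
  obtain ⟨n, rfl⟩ := Nat.exists_eq_add_of_lt hp
  rw [zero_add]
  obtain ⟨a, b, hab⟩ := h n
  intro heq
  rw [hab] at heq
  have h1 := congrArg Complex.im heq
  rw [← Complex.ofReal_pow, Complex.ofReal_im] at h1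
  simp at h1
  have h2 : ((5 * b + 4 : ℤ) : ℝ) = 0 := by
    push_cast
    exact h1
  rw [Int.cast_eq_zero] at h2
  omega

/-- Transition function of an automaton whose start state `0` accepts
`11 ^ n - 2 * 5 ^ n + (gaussPow n).1` words of length `n`. -/
def gaussStep (q : Fin 6) (i : Fin 17) : Fin 6 :=
  match q with
  | 0 => if i < 5 then 0 else if i < 9 then 2 else 4
  | 1 => if i < 5 then 1 else if i < 7 then 2 else if i < 11 then 4 else 5
  | 2 => if i < 5 then 2 else if i < 7 then 1 else if i < 11 then 3 else 5
  | 3 => if i < 5 then 3 else if i < 7 then 4 else if i < 11 then 1 else 5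
  | 4 => if i < 5 then 4 else if i < 7 then 3 else if i < 11 then 2 else 5
  | 5 => 5

lemma acceptCount_gaussStep (n : ℕ) :
    let N := fun q => (acceptCount gaussStep {1, 3} n q : ℤ)
    N 0 = 11 ^ n - 2 * 5 ^ n + (gaussPow n).1 ∧
    2 * N 1 = 11 ^ n + (gaussPow n).1 ∧ 2 * N 2 = 11 ^ n - (gaussPow n).1 ∧
    2 * N 3 = 11 ^ n + (gaussPow n).2 ∧ 2 * N 4 = 11 ^ n - (gaussPow n).2 ∧ N 5 = 0 := by
  induction n with
  | zero => simp [acceptCount, gaussPow]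
  | succ n ih =>
    simp only at ih ⊢
    obtain ⟨h0, h1, h2, h3, h4, h5⟩ := ih
    have hsum : ∀ q, (acceptCount gaussStep {1, 3} (n + 1) q : ℤ) =
        ∑ i, (acceptCount gaussStep {1, 3} n (gaussStep q i) : ℤ) := fun q => by
      rw [acceptCount]
      push_cast
      rfl
    simp only [hsum, gaussPow, pow_succ]
    have e (f : Fin 6 → ℤ) :
        ∑ i, f (gaussStep 0 i) = 5 * f 0 + 4 * f 2 + 8 * f 4 ∧
        ∑ i, f (gaussStep 1 i) = 5 * f 1 + 2 * f 2 + 4 * f 4 + 6 * f 5 ∧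
        ∑ i, f (gaussStep 2 i) = 5 * f 2 + 2 * f 1 + 4 * f 3 + 6 * f 5 ∧
        ∑ i, f (gaussStep 3 i) = 5 * f 3 + 2 * f 4 + 4 * f 1 + 6 * f 5 ∧
        ∑ i, f (gaussStep 4 i) = 5 * f 4 + 2 * f 3 + 4 * f 2 + 6 * f 5 ∧
        ∑ i, f (gaussStep 5 i) = 17 * f 5 := by
      simp only [Fin.sum_univ_succ, Fin.sum_univ_zero]
      simp +decide only [gaussStep, if_true, if_false]
      refine ⟨?_, ?_, ?_, ?_, ?_, ?_⟩ <;> ring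
    obtain ⟨e0, e1, e2, e3, e4, e5⟩ := e fun q => (acceptCount gaussStep {1, 3} n q : ℤ)
    rw [e0, e1, e2, e3, e4, e5]
    refine ⟨?_, ?_, ?_, ?_, ?_, ?_⟩ <;> linarith

/-- Any sequence bounded by the number of words is the counting function of a language. -/
lemma exists_countFn_eq (k : ℕ) (f : ℕ → ℕ) (hf : ∀ n, f n ≤ k ^ n) :
    ∃ L : Set (List (Fin k)), (∀ n, countFn L n = f n) ∧ ∀ n, countFn Lᶜ n = k ^ n - f n := by
  have hcard : ∀ n, {w : List (Fin k) | w.length = n}.ncard = k ^ n := fun n => by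
    have := card_vector (α := Fin k) n
    rw [Fintype.card_fin] at this
    rw [← this, ← Nat.card_eq_fintype_card, ← Nat.card_coe_set_eq]
    rfl
  have hex : ∀ n, ∃ S ⊆ {w : List (Fin k) | w.length = n}, S.ncard = f n := fun n =>
    Set.exists_subset_card_eq ((hf n).trans_eq (hcard n).symm)
  choose S hS hSf using hex
  have h : ∀ n, {w | w ∈ {w | w ∈ S w.length} ∧ w.length = n} = S n := fun n => by
    ext w
    constructor
    · rintro ⟨h, rfl⟩
      exact h
    · intro h
      have : w.length = n := hS n h
      subst this
      exact ⟨h, rfl⟩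
  refine ⟨{w | w ∈ S w.length}, fun n => ?_, fun n => ?_⟩
  · rw [countFn, h, hSf]
  · rw [countFn, ← hcard, ← hSf, ← Set.ncard_sdiff (hS n)
      ((List.finite_length_eq (Fin k) n).subset (hS n)), ← h]
    congr 1
    ext w
    simp
    tauto

/-- No regular language has counting function `2 * 5 ^ n - (gaussPow n).1`. -/
lemma not_countingRegular_of_countFn {α : Type*} (L : Set (List α))
    (hL : ∀ n, (countFn L n : ℤ) = 2 * 5 ^ n - (gaussPow n).1) : ¬ CountingRegular L := by
  rintro ⟨β, _, L', ⟨σ, _, M, hM⟩, hcount⟩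
  obtain rfl : (M.accepts : Set (List β)) = L' := Set.ext hM
  have hstart : ∀ n, (acceptCount M.step M.accept n M.start : ℤ) =
      2 * 5 ^ n - (gaussPow n).1 := fun n => by
    rw [← hL, ← hcount, ← countFn_acceptsFrom]
    rfl
  set M' := M.reachablePart
  have hstart' : ∀ n, (acceptCount M'.step M'.accept n M'.start : ℤ) =
      2 * 5 ^ n - (gaussPow n).1 := fun n => by
    rw [← hstart, DFA.acceptCount_reachablePart]
    rfl
  have hbound : ∀ n, (acceptCount M.step M.accept n M.start : ℝ) ≤ 4 * 5 ^ n := fun n => by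
    have h : (acceptCount M.step M.accept n M.start : ℤ) ≤ 4 * 5 ^ n := by
      rw [hstart]
      have := neg_le_of_abs_le (abs_gaussPow_le n)
      linarith
    exact_mod_cast h
  have hC : ∀ q : {q // ∃ w, M.eval w = q}, ∃ C : ℝ, ∀ n,
      (acceptCount M'.step M'.accept n q : ℝ) ≤ C * 5 ^ n := by
    rintro ⟨_, w, rfl⟩
    refine ⟨4 * 5 ^ w.length, fun n => ?_⟩
    rw [DFA.acceptCount_reachablePart]
    have h1 : (acceptCount M.step M.accept n (M.eval w) : ℝ) ≤
        acceptCount M.step M.accept (n + w.length) M.start := by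
      exact_mod_cast acceptCount_evalFrom_le M M.accept n w M.start
    refine (h1.trans (hbound _)).trans_eq ?_
    rw [pow_add]
    ring
  choose C hC using hC
  obtain ⟨C', hC'⟩ := (Set.finite_range C).bddAbove
  obtain ⟨p, hp, h⟩ := exists_pow_eq_of_growth M'.step M'.accept (l := 3 + 4 * Complex.I)
    (ρ := 5) (by norm_num) (by
      rw [← sq_eq_sq₀ (norm_nonneg _) (by norm_num), ← Complex.normSq_eq_norm_sq,
        Complex.normSq_apply]
      simp
      norm_num)
    (C := C') (fun n q => (hC q n).trans
      (mul_le_mul_of_nonneg_right (hC' ⟨q, rfl⟩) (by positivity))) (by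
      intro P hP
      have hrec : ∀ n, ∑ m ∈ Finset.range (P.natDegree + 1),
          P.coeff m * (2 * 5 ^ (n + m) - ((gaussPow (n + m)).1 : ℂ)) = 0 := by
        intro n
        have h1 := congrArg (fun f => ((transferMap ℂ M'.step) ^ n) f M'.start) hP
        simp only [map_zero, Pi.zero_apply] at h1
        rw [Polynomial.aeval_eq_sum_range, LinearMap.sum_apply, map_sum,
          Finset.sum_apply] at h1
        rw [← h1]
        refine Finset.sum_congr rfl fun m _ => ?_
        rw [LinearMap.smul_apply, map_smul, transferMap_pow_acceptCount,
          transferMap_pow_acceptCount, Pi.smul_apply, smul_eq_mul]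
        have h2 : (acceptCount M'.step M'.accept (n + m) M'.start : ℂ) =
            2 * 5 ^ (n + m) - ((gaussPow (n + m)).1 : ℂ) := by
          exact_mod_cast congrArg (Int.cast : ℤ → ℂ) (hstart' (n + m))
        rw [← h2]
        rfl
      have hev : ∀ n, 2 * 5 ^ n * P.eval 5
          - (1 + Complex.I) / 2 * (3 + 4 * Complex.I) ^ n * P.eval (3 + 4 * Complex.I)
          - (1 - Complex.I) / 2 * (3 - 4 * Complex.I) ^ n * P.eval (3 - 4 * Complex.I) = 0 := by
        intro n
        rw [← hrec n]
        simp only [Polynomial.eval_eq_sum_range, Finset.mul_sum, ← Finset.sum_sub_distrib]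
        refine Finset.sum_congr rfl fun m _ => ?_
        rw [(gaussPow_complex _).1]
        simp only [pow_add]
        ring
      have e0 := hev 0
      have e1 := hev 1
      have e2 := hev 2
      have hI := Complex.I_sq
      rw [Polynomial.IsRoot.def]
      generalize Polynomial.eval (3 + 4 * Complex.I) P = y at *
      have h3 : ((1 + Complex.I) / 2 * (3 + 4 * Complex.I - 5) *
          (3 + 4 * Complex.I - (3 - 4 * Complex.I))) * y = 0 := by
        linear_combination -e2 + (5 + (3 - 4 * Complex.I)) * e1 - 5 * (3 - 4 * Complex.I) * e0
      refine (mul_eq_zero.mp h3).resolve_left fun h4 => ?_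
      have h5 := congrArg Complex.re h4
      simp at h5
      norm_num at h5)
  exact gauss_pow_ne p hp h

/-- There is a counting-regular language whose complement is not counting-regular. -/
theorem stmt16 :
    ∃ (A : Type) (_ : Fintype A) (L : Set (List A)),
      CountingRegular L ∧ ¬ CountingRegular Lᶜ := by
  have hcount := fun n => (acceptCount_gaussStep n).1
  have hle : ∀ n, acceptCount gaussStep {1, 3} n 0 ≤ 11 ^ n := fun n => by
    have h1 := hcount n
    have h2 := (abs_le.mp (abs_gaussPow_le n)).2
    simp only at h1
    have h3 : (acceptCount gaussStep {1, 3} n 0 : ℤ) ≤ 11 ^ n := by linarith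
    exact_mod_cast h3
  obtain ⟨L, hL, hLc⟩ := exists_countFn_eq 11 (fun n => acceptCount gaussStep {1, 3} n 0) hle
  refine ⟨Fin 11, inferInstance, L, ?_, not_countingRegular_of_countFn _ fun n => ?_⟩
  · refine ⟨Fin 17, inferInstance, _, ⟨Fin 6, inferInstance, ⟨gaussStep, 0, {1, 3}⟩,
      fun w => Iff.rfl⟩, fun n => ?_⟩
    rw [hL]
    exact countFn_acceptsFrom ⟨gaussStep, 0, {1, 3}⟩ n 0
  · rw [hLc, Nat.cast_sub (hle n)]
    have h1 := hcount n
    simp only at h1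
    push_cast
    rw [h1]
    ring
end
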